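/- For any two partitions β₁, β₂ and any positive integer s, one has β₁ + (β₂ ⊔ (s)) ≥ (β₁ + β₂) ⊔ (s) in the dominance order, where (s) denotes the partition with the single part s. -/

import Mathlib

/-- A partition: a finite multiset of positive integers. -/
def IsPartition (p : Multiset ℕ) : Prop := ∀ x ∈ p, 0 < x

/-- The parts of `p` in weakly decreasing order. -/
def descList (p : Multiset ℕ) : List ℕ := (p.sort (· ≤ ·)).reverse

/-- The sum of the `j` largest parts of `p` (padding with trailing zeros). -/
def topSum (p : Multiset ℕ) (j : ℕ) : ℕ := ((descList p).take j).sum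

/-- Dominance order: `DomLE α β` means `α ≤ β`, i.e. each partial sum of the
largest parts of `α` is at most the corresponding partial sum for `β`. -/
def DomLE (α β : Multiset ℕ) : Prop := ∀ j : ℕ, topSum α j ≤ topSum β j

/-- Transpose of a partition: the `j`-th part is the number of parts `≥ j`. -/
def transposeP (p : Multiset ℕ) : Multiset ℕ :=
  ((Multiset.range p.sum).map fun j => (p.filter fun x => j + 1 ≤ x).card).filter
    fun c => c ≠ 0

/-- The weakly decreasing list of parts padded with zeros to length `n`. -/
def padDesc (p : Multiset ℕ) (n : ℕ) : List ℕ :=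
  descList p ++ List.replicate (n - Multiset.card p) 0

/-- The sum of two partitions: add the parts pointwise after sorting in
weakly decreasing order and padding with trailing zeros. -/
def sumParts (p q : Multiset ℕ) : Multiset ℕ :=
  (↑(List.zipWith (· + ·)
      (padDesc p (max (Multiset.card p) (Multiset.card q)))
      (padDesc q (max (Multiset.card p) (Multiset.card q)))) : Multiset ℕ).filter
    fun x => x ≠ 0

/-- The string `[a] = (a, a-2, a-4, …, 2 or 1)`, empty for `a = 0`. -/
def strP (a : ℕ) : Multiset ℕ := (Multiset.range ((a + 1) / 2)).map fun k => a - 2 * k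

/-- The partition `(a, a-1, …, 2, 1)`. -/
def downP (a : ℕ) : Multiset ℕ := (Multiset.range a).map fun k => a - k

/-- The partition `(2a-1, 2a-3, …, 3, 1)`. -/
def oddsDown (a : ℕ) : Multiset ℕ := (Multiset.range a).map fun k => 2 * (a - k) - 1

/-- The partition `(2a, 2a-2, …, 4, 2)`. -/
def evensDown (a : ℕ) : Multiset ℕ := (Multiset.range a).map fun k => 2 * (a - k)

/-- `p⁻`: decrease the smallest part of `p` by 1 (deleting it if it was 1). -/
def pMinus (p : Multiset ℕ) : Multiset ℕ :=
  match p.sort (· ≤ ·) with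
  | [] => 0
  | a :: rest => (↑rest : Multiset ℕ) + (if a ≤ 1 then 0 else {a - 1})

/-- A partition is symplectic if every odd part occurs with even multiplicity. -/
def IsSymplectic (p : Multiset ℕ) : Prop := ∀ x : ℕ, Odd x → Even (p.count x)

/-- A partition is orthogonal if every even part occurs with even multiplicity. -/
def IsOrthogonal (p : Multiset ℕ) : Prop := ∀ x : ℕ, Even x → Even (p.count x)

/-- `IsCCollapse p q`: `q` is the C-collapse `p_C` of `p`, i.e. the unique maximal
symplectic partition of the same total that is `≤ p` in the dominance order. -/
def IsCCollapse (p q : Multiset ℕ) : Prop :=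
  IsPartition q ∧ IsSymplectic q ∧ q.sum = p.sum ∧ DomLE q p ∧
    ∀ r : Multiset ℕ, IsPartition r → IsSymplectic r → r.sum = p.sum → DomLE r p → DomLE r q

/-- A multiset presented by a weakly decreasing list is sorted to that list. -/
theorem descList_coe_eq {l : List ℕ} (hl : l.Pairwise (· ≥ ·)) :
    descList (l : Multiset ℕ) = l := by
  have h : (l : Multiset ℕ).sort (· ≤ ·) = l.reverse := by
    refine List.Perm.eq_of_pairwise (le := (· ≤ ·)) (fun a b _ _ => le_antisymm)
      (Multiset.pairwise_sort _ _) (List.pairwise_reverse.2 hl) ?_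
    rw [← Multiset.coe_eq_coe, Multiset.sort_eq, Multiset.coe_reverse]
  rw [descList, h, List.reverse_reverse]

theorem pairwise_descList (p : Multiset ℕ) : (descList p).Pairwise (· ≥ ·) :=
  List.pairwise_reverse.2 (Multiset.pairwise_sort p _)

theorem coe_descList (p : Multiset ℕ) : (descList p : Multiset ℕ) = p := by
  rw [descList, Multiset.coe_reverse, Multiset.sort_eq]

theorem length_descList (p : Multiset ℕ) : (descList p).length = p.card := by
  simp [descList]

theorem List.sum_take_succ_le_add {l : List ℕ} {s : ℕ} (h : ∀ x ∈ l, x ≤ s) (j : ℕ) :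
    (l.take (j + 1)).sum ≤ (l.take j).sum + s := by
  induction l generalizing j with
  | nil => simp
  | cons a l ih =>
    cases j with
    | zero => simpa using h a (by simp)
    | succ j =>
      have := ih (fun x hx => h x (by simp [hx])) j
      simp only [List.take_succ_cons, List.sum_cons] at this ⊢
      omega

/-- Inserting `s` into a weakly decreasing list: the `j + 1` largest elements either avoid `s`
or consist of `s` and the `j` largest elements of the original list. -/
theorem List.sum_take_succ_orderedInsert {l : List ℕ} (hl : l.Pairwise (· ≥ ·)) (s j : ℕ) :
    ((l.orderedInsert (· ≥ ·) s).take (j + 1)).sum =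
      max (l.take (j + 1)).sum ((l.take j).sum + s) := by
  induction l generalizing j with
  | nil => simp
  | cons a l ih =>
    rw [List.pairwise_cons] at hl
    rw [List.orderedInsert_cons]
    split_ifs with h
    · have := List.sum_take_succ_le_add (l := a :: l) (s := s)
        (by simpa using ⟨h, fun x hx => (hl.1 x hx).trans h⟩) j
      rw [List.take_succ_cons (a := s), List.sum_cons]
      omega
    · cases j with
      | zero => simp; omega
      | succ j =>
        have := ih hl.2 j
        simp only [List.take_succ_cons, List.sum_cons] at this ⊢
        omega

theorem topSum_succ_add_singleton (p : Multiset ℕ) (s j : ℕ) :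
    topSum (p + {s}) (j + 1) = max (topSum p (j + 1)) (topSum p j + s) := by
  have hp := pairwise_descList p
  have h : p + {s} = ((descList p).orderedInsert (· ≥ ·) s : Multiset ℕ) := by
    rw [Multiset.coe_eq_coe.2 (List.perm_orderedInsert _ s (descList p)), ← Multiset.cons_coe,
      coe_descList, add_comm, Multiset.singleton_add]
  rw [h, topSum, descList_coe_eq (hp.orderedInsert s _), List.sum_take_succ_orderedInsert hp]
  rfl

theorem topSum_mono (p : Multiset ℕ) {i j : ℕ} (h : i ≤ j) : topSum p i ≤ topSum p j :=
  (List.take_sublist_take_left h).sum_le_sum (by simp)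

theorem List.sum_take_filter_ne_zero {l : List ℕ} (hl : l.Pairwise (· ≥ ·)) (j : ℕ) :
    ((l.filter (· ≠ 0)).take j).sum = (l.take j).sum := by
  induction l generalizing j with
  | nil => simp
  | cons a l ih =>
    rw [List.pairwise_cons] at hl
    cases j with
    | zero => simp
    | succ j =>
      by_cases ha : a = 0
      · subst ha
        have hz : ∀ x ∈ l, x = 0 := fun x hx => Nat.le_zero.1 (hl.1 x hx)
        have hf : (0 :: l).filter (· ≠ 0) = [] := by simpa using hz
        rw [hf, List.take_nil, List.sum_nil, eq_comm, List.sum_eq_zero_iff]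
        intro x hx
        simpa using (List.mem_cons.1 (List.mem_of_mem_take hx)).elim id (hz x)
      · rw [List.filter_cons_of_pos (by simpa using ha)]
        simp only [List.take_succ_cons, List.sum_cons, ih hl.2]

theorem List.pairwise_zipWith_add {l m : List ℕ} (hl : l.Pairwise (· ≥ ·))
    (hm : m.Pairwise (· ≥ ·)) : (List.zipWith (· + ·) l m).Pairwise (· ≥ ·) := by
  rw [List.pairwise_iff_getElem] at *
  intro i j hi hj hij
  simp only [List.length_zipWith, lt_inf_iff] at hi hj
  simp only [List.getElem_zipWith]
  exact add_le_add (hl i j hi.1 hj.1 hij) (hm i j hi.2 hj.2 hij)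

theorem List.sum_take_zipWith_add {l m : List ℕ} (h : l.length = m.length) (j : ℕ) :
    ((List.zipWith (· + ·) l m).take j).sum = (l.take j).sum + (m.take j).sum := by
  induction l generalizing m j with
  | nil => simp_all [eq_comm]
  | cons a l ih =>
    cases m with
    | nil => simp at h
    | cons b m =>
      cases j with
      | zero => simp
      | succ j =>
        simp only [List.zipWith_cons_cons, List.take_succ_cons, List.sum_cons,
          ih (Nat.succ.inj h)]
        omega

theorem pairwise_padDesc (p : Multiset ℕ) (n : ℕ) : (padDesc p n).Pairwise (· ≥ ·) := by
  refine List.pairwise_append.2 ⟨pairwise_descList p, ?_, ?_⟩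
  · simp [List.pairwise_replicate]
  · intro a _ b hb
    simp [List.eq_of_mem_replicate hb]

theorem length_padDesc {p : Multiset ℕ} {n : ℕ} (h : p.card ≤ n) : (padDesc p n).length = n := by
  simp [padDesc, length_descList, h]

theorem sum_take_padDesc (p : Multiset ℕ) (n j : ℕ) :
    ((padDesc p n).take j).sum = topSum p j := by
  simp [padDesc, topSum, List.take_append]

theorem topSum_sumParts (p q : Multiset ℕ) (j : ℕ) :
    topSum (sumParts p q) j = topSum p j + topSum q j := by
  have hz := List.pairwise_zipWith_add (pairwise_padDesc p (max p.card q.card))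
    (pairwise_padDesc q (max p.card q.card))
  rw [sumParts, topSum, Multiset.filter_coe, descList_coe_eq (hz.filter _),
    List.sum_take_filter_ne_zero hz, List.sum_take_zipWith_add, sum_take_padDesc,
    sum_take_padDesc]
  rw [length_padDesc (le_max_left _ _), length_padDesc (le_max_right _ _)]

/-- for any two partitions `β₁, β₂` and any `s ≥ 1`,
`β₁ + (β₂ ⊔ (s)) ≥ (β₁ + β₂) ⊔ (s)` in the dominance order. -/
theorem sumParts_concat_singleton (β₁ β₂ : Multiset ℕ) (s : ℕ)
    (hβ₁ : IsPartition β₁) (hβ₂ : IsPartition β₂) (hs : 1 ≤ s) :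
    DomLE (sumParts β₁ β₂ + ({s} : Multiset ℕ)) (sumParts β₁ (β₂ + ({s} : Multiset ℕ))) := by
  intro j
  cases j with
  | zero => simp [topSum]
  | succ j =>
    have := topSum_mono β₁ (Nat.le_add_right j 1)
    simp only [topSum_sumParts, topSum_succ_add_singleton]
    omega
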